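/- arXiv:1001.3625 — 3 statements merged into one kernel-verified Lean document; each statement's English description precedes it below -/
import Mathlib

section
/- For every w ∈ 𝕋, every z ∈ ℂ \ {0} and every p ∈ 𝕋^{4M}, one has A_{wz}(p) = A_z(w ⊙ p), where w ⊙ p ∈ 𝕋^{4M} is defined by (w ⊙ p)_{2j} := w^{−1} p_{2j} and (w ⊙ p)_{2j+1} := w p_{2j+1} for all admissible indices j. -/
open Matrix Complex

noncomputable section

/-- `D(q)`: the diagonal matrix with diagonal entries `q₁, …, q_{2M}`. -/
def Dmat (M : ℕ) (q : Fin (2 * M) → ℂ) : Matrix (Fin (2 * M)) (Fin (2 * M)) ℂ :=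
  Matrix.diagonal q

/-- `M₁(z)`: block diagonal with `M` consecutive `2×2` diagonal blocks
`(1/t)[[z̄, −r],[−r, z]]`. -/
def M1mat (M : ℕ) (r t : ℝ) (z : ℂ) : Matrix (Fin (2 * M)) (Fin (2 * M)) ℂ :=
  Matrix.of fun a b =>
    if (a : ℕ) / 2 = (b : ℕ) / 2 then
      (if a = b then (if (a : ℕ) % 2 = 0 then (starRingEnd ℂ) z else z) else -(r : ℂ)) / (t : ℂ)
    else 0

/-- `M₂(z)`: the matrix with corner entries `M₂_{1,1} = −z̄/r`, `M₂_{1,2M} = t/r`,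
`M₂_{2M,1} = −t/r`, `M₂_{2M,2M} = z/r` and `2×2` diagonal blocks `(1/r)[[z, −t],[t, −z̄]]`
on (1-based) rows and columns `(2k, 2k+1)`, `k = 1, …, M−1`, all other entries `0`;
equivalently, the cyclically shifted block-diagonal matrix with blocks
`(1/r)[[z, −t],[t, −z̄]]` on the (0-based, cyclic) index pairs `(2k+1, 2k+2 mod 2M)`. -/
def M2mat (M : ℕ) (r t : ℝ) (z : ℂ) : Matrix (Fin (2 * M)) (Fin (2 * M)) ℂ :=
  Matrix.of fun a b =>
    if ((a : ℕ) + 1) % (2 * M) / 2 = ((b : ℕ) + 1) % (2 * M) / 2 then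
      (if a = b then (if (a : ℕ) % 2 = 1 then z else -((starRingEnd ℂ) z))
        else (if (a : ℕ) % 2 = 1 then -(t : ℂ) else (t : ℂ))) / (r : ℂ)
    else 0

/-- `p_r := (1, p₁, 1, p₃, …, 1, p_{2M−1})` (0-based: entries of `p` with odd index `< 2M`). -/
def pR (M : ℕ) (p : Fin (4 * M) → ℂ) : Fin (2 * M) → ℂ :=
  fun i => if (i : ℕ) % 2 = 0 then 1 else p (Fin.castLE (by omega) i)

/-- `p_l := (p₀, 1, p₂, 1, …, p_{2M−2}, 1)` (0-based: entries of `p` with even index `< 2M`). -/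
def pL (M : ℕ) (p : Fin (4 * M) → ℂ) : Fin (2 * M) → ℂ :=
  fun i => if (i : ℕ) % 2 = 0 then p (Fin.castLE (by omega) i) else 1

/-- `p_m := (p_{2M}, …, p_{4M−1})`. -/
def pM (M : ℕ) (p : Fin (4 * M) → ℂ) : Fin (2 * M) → ℂ :=
  fun i => p ⟨2 * M + (i : ℕ), by have := i.isLt; omega⟩

/-- The transfer matrix `A_z(p) := D(p_l) M₂(z) D(p_m) M₁(z) D(p_r)`. -/
def Az (M : ℕ) (r t : ℝ) (z : ℂ) (p : Fin (4 * M) → ℂ) :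
    Matrix (Fin (2 * M)) (Fin (2 * M)) ℂ :=
  Dmat M (pL M p) * M2mat M r t z * Dmat M (pM M p) * M1mat M r t z * Dmat M (pR M p)

end

/-- The even-indexed part `(w⁻¹, 1, w⁻¹, 1, …)` of the modulation. -/
noncomputable def evenPhase (M : ℕ) (w : ℂ) (i : Fin (2 * M)) : ℂ :=
  if (i : ℕ) % 2 = 0 then w⁻¹ else 1

/-- The odd-indexed part `(1, w, 1, w, …)` of the modulation. -/
def oddPhase (M : ℕ) (w : ℂ) (i : Fin (2 * M)) : ℂ :=
  if (i : ℕ) % 2 = 0 then 1 else w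

theorem M1mat_phase_mul (M : ℕ) (r t : ℝ) {w : ℂ} (hw : ‖w‖ = 1) (z : ℂ) (a b : Fin (2 * M)) :
    M1mat M r t (w * z) a b = evenPhase M w a * M1mat M r t z a b * oddPhase M w b := by
  have hw0 : w ≠ 0 := norm_ne_zero_iff.mp (by simp [hw])
  have hconj : (starRingEnd ℂ) w = w⁻¹ := (Complex.inv_eq_conj hw).symm
  simp only [M1mat, Matrix.of_apply, evenPhase, oddPhase]
  by_cases hblock : (a : ℕ) / 2 = (b : ℕ) / 2
  · by_cases hab : a = b
    · subst hab
      by_cases ha : (a : ℕ) % 2 = 0 <;> simp [ha, hconj] <;> ring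
    · have hne : (a : ℕ) ≠ b := Fin.val_ne_of_ne hab
      by_cases ha : (a : ℕ) % 2 = 0
      · have hb : ¬ (b : ℕ) % 2 = 0 := by omega
        simp only [hblock, hab, ha, hb, if_true, if_false]
        field_simp
      · have hb : (b : ℕ) % 2 = 0 := by omega
        simp [hblock, hab, ha, hb]
  · simp [hblock]

theorem M2mat_phase_mul (M : ℕ) (r t : ℝ) {w : ℂ} (hw : ‖w‖ = 1) (z : ℂ) (a b : Fin (2 * M)) :
    M2mat M r t (w * z) a b = evenPhase M w a * M2mat M r t z a b * oddPhase M w b := by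
  have hw0 : w ≠ 0 := norm_ne_zero_iff.mp (by simp [hw])
  have hconj : (starRingEnd ℂ) w = w⁻¹ := (Complex.inv_eq_conj hw).symm
  have hmod (c : Fin (2 * M)) :
      ((c : ℕ) + 1 < 2 * M ∧ ((c : ℕ) + 1) % (2 * M) = c + 1) ∨
        ((c : ℕ) + 1 = 2 * M ∧ ((c : ℕ) + 1) % (2 * M) = 0) := by
    rcases Nat.lt_or_ge ((c : ℕ) + 1) (2 * M) with h | h
    · exact Or.inl ⟨h, Nat.mod_eq_of_lt h⟩
    · have h' : (c : ℕ) + 1 = 2 * M := by omega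
      exact Or.inr ⟨h', by rw [h', Nat.mod_self]⟩
  simp only [M2mat, Matrix.of_apply, evenPhase, oddPhase]
  by_cases hblock : ((a : ℕ) + 1) % (2 * M) / 2 = ((b : ℕ) + 1) % (2 * M) / 2
  · by_cases hab : a = b
    · subst hab
      by_cases ha : (a : ℕ) % 2 = 0
      · simp [ha, hconj]
        ring
      · have ha' : (a : ℕ) % 2 = 1 := by omega
        simp [ha']
        ring
    · have hne : (a : ℕ) ≠ b := Fin.val_ne_of_ne hab
      have hpar : (a : ℕ) % 2 ≠ (b : ℕ) % 2 := by
        rcases hmod a with ⟨_, ea⟩ | ⟨_, ea⟩ <;> rcases hmod b with ⟨_, eb⟩ | ⟨_, eb⟩ <;>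
          rw [ea, eb] at hblock <;> omega
      by_cases ha : (a : ℕ) % 2 = 0
      · have hb : ¬ (b : ℕ) % 2 = 0 := by omega
        simp only [hblock, hab, ha, hb, if_true, if_false]
        field_simp
      · have hb : (b : ℕ) % 2 = 0 := by omega
        simp [hblock, hab, ha, hb]
  · simp [hblock]

theorem Az_apply (M : ℕ) (r t : ℝ) (z : ℂ) (p : Fin (4 * M) → ℂ) (i j : Fin (2 * M)) :
    Az M r t z p i j =
      ∑ k, pL M p i * M2mat M r t z i k * pM M p k * M1mat M r t z k j * pR M p j := by
  simp only [Az, Dmat, Matrix.mul_diagonal, Matrix.mul_apply (N := M1mat M r t z),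
    Matrix.diagonal_mul, Finset.sum_mul]

/-- For every `w ∈ 𝕋`, every `z ≠ 0` and every `p ∈ 𝕋^{4M}`,
`A_{wz}(p) = A_z(w ⊙ p)`, where `(w ⊙ p)_{2j} = w⁻¹ p_{2j}` and `(w ⊙ p)_{2j+1} = w p_{2j+1}`. -/
theorem stmt_6 (M : ℕ) (hM : 1 ≤ M) (r t : ℝ) (hr : r ∈ Set.Ioo (0 : ℝ) 1)
    (ht : t ∈ Set.Ioo (0 : ℝ) 1) (hrt : r ^ 2 + t ^ 2 = 1)
    (w : ℂ) (hw : ‖w‖ = 1) (z : ℂ) (hz : z ≠ 0)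
    (p : Fin (4 * M) → ℂ) (hp : ∀ i, ‖p i‖ = 1) :
    Az M r t (w * z) p =
      Az M r t z (fun i => if (i : ℕ) % 2 = 0 then w⁻¹ * p i else w * p i) := by
  set p' : Fin (4 * M) → ℂ := fun i => if (i : ℕ) % 2 = 0 then w⁻¹ * p i else w * p i with hp'
  have hL (i : Fin (2 * M)) : pL M p' i = evenPhase M w i * pL M p i := by
    by_cases h : (i : ℕ) % 2 = 0 <;> simp [pL, evenPhase, hp', h]
  have hR (i : Fin (2 * M)) : pR M p' i = oddPhase M w i * pR M p i := by
    by_cases h : (i : ℕ) % 2 = 0 <;> simp [pR, oddPhase, hp', h]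
  have hMid (i : Fin (2 * M)) : pM M p' i = oddPhase M w i * evenPhase M w i * pM M p i := by
    by_cases h : (i : ℕ) % 2 = 0 <;> simp [pM, oddPhase, evenPhase, hp', h]
  ext i j
  rw [Az_apply, Az_apply]
  refine Finset.sum_congr rfl fun k _ => ?_
  rw [M1mat_phase_mul M r t hw, M2mat_phase_mul M r t hw, hL, hR, hMid]
  ring
end

section
/- Fix z ∈ 𝕋. Every transfer matrix A_z(p), p ∈ 𝕋^{4M}, belongs to U_M(1,1), and the topological closure (in GL_{2M}(ℂ)) of the subgroup of GL_{2M}(ℂ) generated by the set {A_z(p) : p ∈ 𝕋^{4M}} is exactly U_M(1,1). -/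
open Matrix Complex

/-- The matrix `𝕁 ∈ M_{2M}(ℂ)`: block-diagonal with `M` diagonal blocks `J = diag(1,−1)`,
i.e. the diagonal matrix with entries `1, −1, 1, −1, …`. -/
noncomputable def JJ (M : ℕ) : Matrix (Fin (2 * M)) (Fin (2 * M)) ℂ :=
  Matrix.diagonal fun i => if (i : ℕ) % 2 = 0 then 1 else -1


section CrossMatrices

variable {ι : Type*} [Fintype ι] [DecidableEq ι]

/-- The matrix acting on vectors by `v ↦ fun k => α k * v k + β k * v (σ k)`. -/
def crossMat (σ : ι → ι) (α β : ι → ℂ) : Matrix ι ι ℂ :=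
  Matrix.of fun k l => (if k = l then α k else 0) + if σ k = l then β k else 0

lemma crossMat_mulVec (σ : ι → ι) (α β v : ι → ℂ) (k : ι) :
    (crossMat σ α β *ᵥ v) k = α k * v k + β k * v (σ k) := by
  simp [crossMat, Matrix.mulVec, dotProduct, add_mul, Finset.sum_add_distrib]

omit [Fintype ι] in
lemma diagonal_eq_crossMat (σ : ι → ι) (q : ι → ℂ) :
    Matrix.diagonal q = crossMat σ q 0 := by
  ext k l
  simp [crossMat, Matrix.diagonal_apply]

lemma crossMat_mul {σ : ι → ι} (hσ : Function.Involutive σ) (α β α' β' : ι → ℂ) :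
    crossMat σ α β * crossMat σ α' β' =
      crossMat σ (fun k => α k * α' k + β k * β' (σ k))
        (fun k => α k * β' k + β k * α' (σ k)) := by
  refine Matrix.ext_of_mulVec_single fun i => ?_
  rw [← Matrix.mulVec_mulVec]
  ext k
  simp only [crossMat_mulVec, hσ k]
  ring

omit [Fintype ι] in
lemma crossMat_conjTranspose {σ : ι → ι} (hσ : Function.Involutive σ) (α β : ι → ℂ) :
    (crossMat σ α β)ᴴ = crossMat σ (fun k => star (α k)) (fun k => star (β (σ k))) := by
  ext k l
  have h : σ l = k ↔ σ k = l := ⟨fun h => by rw [← h, hσ], fun h => by rw [← h, hσ]⟩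
  by_cases h1 : k = l
  · subst h1
    by_cases h2 : σ k = k <;> simp [crossMat, Matrix.conjTranspose_apply, h2]
  · have h1' : ¬ l = k := fun h => h1 h.symm
    by_cases h2 : σ k = l
    · subst h2
      simp [crossMat, Matrix.conjTranspose_apply, h1, h1', hσ k]
    · simp [crossMat, Matrix.conjTranspose_apply, h, h1, h1', h2]

lemma diagonal_mul_crossMat_mul_diagonal (σ : ι → ι) (d e α β : ι → ℂ) :
    Matrix.diagonal d * crossMat σ α β * Matrix.diagonal e =
      crossMat σ (fun k => d k * α k * e k) (fun k => d k * β k * e (σ k)) := by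
  ext k l
  simp only [crossMat, Matrix.mul_diagonal, Matrix.diagonal_mul, Matrix.of_apply, mul_add, add_mul,
    mul_ite, ite_mul, mul_zero, zero_mul]
  congr 1
  · split_ifs with h <;> simp [h]
  · split_ifs with h <;> simp [h]

/-- The hyperbolic rotation with parameter `s` in the coordinates `i` and `j`. -/
noncomputable def boost (i j : ι) (s : ℝ) : Matrix ι ι ℂ :=
  crossMat (Equiv.swap i j) (fun k => if k = i ∨ k = j then (Real.cosh s : ℂ) else 1)
    (fun k => if k = i ∨ k = j then (Real.sinh s : ℂ) else 0)

omit [Fintype ι] in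
lemma boost_zero (i j : ι) : boost i j 0 = 1 := by
  rw [← Matrix.diagonal_one, diagonal_eq_crossMat (Equiv.swap i j)]
  simp [boost]
  rfl

lemma boost_mul_boost (i j : ι) (s s' : ℝ) : boost i j s * boost i j s' = boost i j (s + s') := by
  have h : ∀ k, (Equiv.swap i j k = i ∨ Equiv.swap i j k = j) ↔ (k = i ∨ k = j) := by
    intro k
    by_cases h1 : k = i
    · simp [h1]
    by_cases h2 : k = j
    · simp [h2]
    simp [Equiv.swap_apply_of_ne_of_ne h1 h2]
  rw [boost, boost, crossMat_mul (Equiv.swap_apply_self i j)]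
  simp only [h, boost, Real.cosh_add, Real.sinh_add]
  congr 1 <;> ext k <;> split_ifs <;> push_cast <;> ring

lemma boost_mulVec_left {i j : ι} (s : ℝ) (v : ι → ℂ) :
    (boost i j s *ᵥ v) i = Real.cosh s * v i + Real.sinh s * v j := by
  simp [boost, crossMat_mulVec]

lemma boost_mulVec_right {i j : ι} (s : ℝ) (v : ι → ℂ) :
    (boost i j s *ᵥ v) j = Real.cosh s * v j + Real.sinh s * v i := by
  simp [boost, crossMat_mulVec]

lemma boost_mulVec_of_ne {i j k : ι} (s : ℝ) (v : ι → ℂ) (hi : k ≠ i) (hj : k ≠ j) :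
    (boost i j s *ᵥ v) k = v k := by
  simp [boost, crossMat_mulVec, hi, hj]

/-- A pseudo-unitary `2 × 2` block obtained by conjugating `diag(w, 1)` has the polar form of a
boost; this solves for `w` given the boost parameter. -/
lemma exists_phases_of_cosh_le {A s : ℝ} {γ : ℂ} (hA : 1 < A) (hγ : ‖γ‖ ^ 2 = A * (A - 1))
    (hs : Real.cosh s ≤ 2 * A - 1) :
    ∃ w u u' : ℂ, ‖w‖ = 1 ∧ ‖u‖ = 1 ∧ ‖u'‖ = 1 ∧
      A * w - (A - 1) = u * Real.cosh s ∧ γ * (w - 1) = u' * Real.sinh s := by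
  have h1 := Real.one_le_cosh s
  have hAA : 0 < 2 * A * (A - 1) := by nlinarith
  set x : ℝ := (A ^ 2 + (A - 1) ^ 2 - Real.cosh s ^ 2) / (2 * A * (A - 1)) with hx
  have hx' : x * (2 * A * (A - 1)) = A ^ 2 + (A - 1) ^ 2 - Real.cosh s ^ 2 :=
    div_mul_cancel₀ _ hAA.ne'
  have hx1 : x ≤ 1 := by rw [hx, div_le_one hAA]; nlinarith
  have hx2 : -1 ≤ x := by rw [hx, le_div_iff₀ hAA]; nlinarith
  have hsq : Real.sqrt (1 - x ^ 2) ^ 2 = 1 - x ^ 2 := Real.sq_sqrt (by nlinarith)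
  set y := Real.sqrt (1 - x ^ 2)
  have hpos : 0 < Real.cosh s := Real.cosh_pos s
  have hw : ‖(⟨x, y⟩ : ℂ)‖ = 1 := by
    rw [← sq_eq_sq₀ (norm_nonneg _) zero_le_one, ← Complex.normSq_eq_norm_sq, Complex.normSq_mk]
    nlinarith
  have ha : ‖(A : ℂ) * ⟨x, y⟩ - (A - 1)‖ = Real.cosh s := by
    rw [← sq_eq_sq₀ (norm_nonneg _) hpos.le, ← Complex.normSq_eq_norm_sq, Complex.normSq_apply]
    simp
    nlinarith
  have hb : ‖γ * (⟨x, y⟩ - 1)‖ = |Real.sinh s| := by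
    rw [← sq_eq_sq₀ (norm_nonneg _) (abs_nonneg _), norm_mul, mul_pow, hγ, sq_abs, Real.sinh_sq,
      ← Complex.normSq_eq_norm_sq, Complex.normSq_apply]
    simp
    nlinarith
  refine ⟨⟨x, y⟩, (A * ⟨x, y⟩ - (A - 1)) / Real.cosh s,
    if Real.sinh s = 0 then 1 else γ * (⟨x, y⟩ - 1) / Real.sinh s, hw, ?_, ?_, ?_, ?_⟩
  · rw [norm_div, ha, Complex.norm_real, Real.norm_of_nonneg hpos.le, div_self hpos.ne']
  · split_ifs with h
    · simp
    · rw [norm_div, hb, Complex.norm_real, Real.norm_eq_abs, div_self (abs_pos.2 h).ne']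
  · rw [div_mul_cancel₀]
    exact_mod_cast hpos.ne'
  · split_ifs with h
    · rw [h, abs_zero, norm_eq_zero] at hb
      simp [hb, h]
    · rw [div_mul_cancel₀]
      exact_mod_cast h

/-- If a submonoid contains the boosts with `cosh s ≤ C`, where `C > 1`, it contains all boosts. -/
lemma boost_mem_of_small {N : Submonoid (Matrix ι ι ℂ)} {i j : ι} {C : ℝ} (hC : 1 < C)
    (h : ∀ s, Real.cosh s ≤ C → boost i j s ∈ N) (s : ℝ) : boost i j s ∈ N := by
  have hlim : Filter.Tendsto (fun m : ℕ => Real.cosh (s / m)) Filter.atTop (nhds 1) := by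
    have := (Real.continuous_cosh.tendsto 0).comp (tendsto_const_div_atTop_nhds_zero_nat s)
    simpa [Function.comp_def] using this
  obtain ⟨m, hm, hm0⟩ := ((hlim.eventually_le_const hC).and (Filter.eventually_gt_atTop 0)).exists
  have hpow : ∀ k : ℕ, boost i j (s / m) ^ k = boost i j (k * (s / m)) := by
    intro k
    induction k with
    | zero => simp [boost_zero]
    | succ k ih =>
      rw [pow_succ, ih, boost_mul_boost]
      congr 1
      push_cast
      ring
  have := N.pow_mem (h _ hm) m
  rwa [hpow, mul_div_cancel₀] at this
  exact Nat.cast_ne_zero.2 (Nat.pos_iff_ne_zero.1 hm0)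

/-- Coefficients for which `crossMat σ α β` is pseudo-unitary for every form `∑ ε k * |v k| ^ 2`
with `ε k = 1` or `ε k = -1` and `ε (σ k) = -ε k`. -/
structure IsCrossUnitary (σ : ι → ι) (α β : ι → ℂ) (A : ℝ) : Prop where
  involutive : Function.Involutive σ
  one_lt : 1 < A
  star_mul_left : ∀ k, star (α k) * α k = A
  star_mul_right : ∀ k, star (β k) * β k = A - 1
  star_mul_cross : ∀ k, star (α k) * β k = star (β (σ k)) * α (σ k)

namespace IsCrossUnitary

variable {σ : ι → ι} {α β : ι → ℂ} {A : ℝ}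

/-- The inverse of `crossMat σ α β`. -/
def inv (σ : ι → ι) (α β : ι → ℂ) : Matrix ι ι ℂ :=
  crossMat σ (fun k => star (α k)) (fun k => -star (β (σ k)))

omit [Fintype ι] [DecidableEq ι] in
lemma inv_coeff (h : IsCrossUnitary σ α β A) :
    IsCrossUnitary σ (fun k => star (α k)) (fun k => -star (β (σ k))) A where
  involutive := h.involutive
  one_lt := h.one_lt
  star_mul_left k := by rw [star_star, mul_comm, h.star_mul_left]
  star_mul_right k := by rw [star_neg, star_star, neg_mul_neg, mul_comm, h.star_mul_right]
  star_mul_cross k := by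
    have hA : (A : ℂ) ≠ 0 := by exact_mod_cast (zero_lt_one.trans h.one_lt).ne'
    have h1 := h.star_mul_left k
    have h2 := h.star_mul_left (σ k)
    have h3 := h.star_mul_cross k
    rw [star_star, star_neg, star_star, h.involutive k]
    refine mul_left_cancel₀ hA ?_
    linear_combination α k * star (α (σ k)) * h3 - star (α (σ k)) * β k * h1 +
      α k * star (β (σ k)) * h2

omit [Fintype ι] in
lemma inv_inv_coeff (h : IsCrossUnitary σ α β A) :
    inv σ (fun k => star (α k)) (fun k => -star (β (σ k))) = crossMat σ α β := by
  simp [inv, h.involutive _]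

lemma conj_diagonal (h : IsCrossUnitary σ α β A) (q : ι → ℂ) :
    inv σ α β * Matrix.diagonal q * crossMat σ α β =
      crossMat σ (fun k => A * q k - (A - 1) * q (σ k))
        (fun k => star (α k) * β k * (q k - q (σ k))) := by
  rw [inv, diagonal_eq_crossMat σ, crossMat_mul h.involutive, crossMat_mul h.involutive]
  congr 1 <;> ext k
  · simp only [Pi.zero_apply]
    linear_combination q k * h.star_mul_left k - q (σ k) * h.star_mul_right (σ k)
  · simp only [Pi.zero_apply]
    linear_combination q (σ k) * h.star_mul_cross k

lemma inv_mul (h : IsCrossUnitary σ α β A) : inv σ α β * crossMat σ α β = 1 := by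
  have := h.conj_diagonal 1
  rw [Matrix.diagonal_one', Matrix.mul_one] at this
  rw [this, ← Matrix.diagonal_one, diagonal_eq_crossMat σ]
  congr 1 <;> ext k <;> simp

lemma conjTranspose_mul_mul (h : IsCrossUnitary σ α β A) {ε : ι → ℂ}
    (hε : ∀ k, ε (σ k) = -ε k) :
    (crossMat σ α β)ᴴ * Matrix.diagonal ε * crossMat σ α β = Matrix.diagonal ε := by
  rw [crossMat_conjTranspose h.involutive, diagonal_eq_crossMat σ, crossMat_mul h.involutive,
    crossMat_mul h.involutive]
  congr 1 <;> ext k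
  · simp only [Pi.zero_apply, hε]
    linear_combination ε k * h.star_mul_left k - ε k * h.star_mul_right (σ k)
  · simp only [Pi.zero_apply, hε]
    linear_combination ε k * h.star_mul_cross k

lemma boost_mem (h : IsCrossUnitary σ α β A) {N : Submonoid (Matrix ι ι ℂ)}
    (hN : ∀ q : ι → ℂ, (∀ k, ‖q k‖ = 1) → Matrix.diagonal q ∈ N)
    (hC : ∀ q : ι → ℂ, (∀ k, ‖q k‖ = 1) →
      inv σ α β * Matrix.diagonal q * crossMat σ α β ∈ N)
    {i : ι} (hi : σ i ≠ i) (s : ℝ) : boost i (σ i) s ∈ N := by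
  obtain ⟨hσ, hA, hα, hβ, hαβ⟩ := id h
  refine boost_mem_of_small (C := 2 * A - 1) (by linarith) (fun s hs => ?_) s
  have hγ : ‖star (α i) * β i‖ ^ 2 = A * (A - 1) := by
    have h1 := hα i
    have h2 := hβ i
    simp only [Complex.star_def, Complex.conj_mul'] at h1 h2
    have h1' : ‖α i‖ ^ 2 = A := by exact_mod_cast h1
    have h2' : ‖β i‖ ^ 2 = A - 1 := by exact_mod_cast h2
    rw [norm_mul, norm_star, mul_pow, h1', h2']
  obtain ⟨w, u, u', hw, hu, hu', h1, h2⟩ := exists_phases_of_cosh_le hA hγ hs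
  have sq : ∀ {x : ℂ}, ‖x‖ = 1 → star x * x = 1 := fun {x} hx => by
    rw [Complex.star_def, Complex.conj_mul', hx]; simp
  have h1' : star (u * (Real.cosh s : ℂ)) = A * star w - (A - 1) := by rw [← h1]; simp
  have h2' : star (u' * (Real.sinh s : ℂ)) = star (star (α i) * β i) * (star w - 1) := by
    rw [← h2]; simp
  simp only [star_mul', Complex.star_def, Complex.conj_ofReal] at h1' h2'
  have hq : ∀ k, ‖(if k = i then w else 1 : ℂ)‖ = 1 := fun k => by split_ifs <;> simp [hw]
  have hd : ∀ k, ‖(if k = σ i then star w * u * u' else 1 : ℂ)‖ = 1 := fun k => by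
    split_ifs <;> simp [hw, hu, hu']
  have he : ∀ k, ‖(if k = i then star u else if k = σ i then star u' else 1 : ℂ)‖ = 1 :=
    fun k => by split_ifs <;> simp [hu, hu']
  have key := N.mul_mem (N.mul_mem (hN _ hd) (hC _ hq)) (hN _ he)
  rw [h.conj_diagonal, diagonal_mul_crossMat_mul_diagonal] at key
  convert key using 1
  have hw' := sq hw
  have huu := sq hu
  have huu' := sq hu'
  simp only [Complex.star_def] at hw' huu huu' hαβ h1 h2 key ⊢
  refine Matrix.ext_of_mulVec_single fun l => ?_
  ext k
  by_cases hki : k = i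
  · subst hki
    rw [boost_mulVec_left, crossMat_mulVec]
    simp only [hi, hi.symm, if_true, if_false]
    linear_combination
      (-(starRingEnd ℂ) u * h1 - Real.cosh s * huu) * Pi.single (M := fun _ => ℂ) l 1 k +
      (-(starRingEnd ℂ) u' * h2 - Real.sinh s * huu') * Pi.single (M := fun _ => ℂ) l 1 (σ k)
  by_cases hkj : k = σ i
  · subst hkj
    have hαβi := hαβ (σ i)
    rw [hσ i] at hαβi
    rw [boost_mulVec_right, crossMat_mulVec, hσ i]
    simp only [hi, hi.symm, if_true, if_false, hαβi]
    simp only [Complex.conj_conj] at h1' h2'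
    set a := (starRingEnd ℂ) u
    set a' := (starRingEnd ℂ) u'
    set b := (starRingEnd ℂ) w
    have e1 : b * u * u' * (A * 1 - (A - 1) * w) * a' = Real.cosh s := by
      linear_combination b * u * (A - (A - 1) * w) * huu' - u * (A - 1) * hw' - u * h1' +
        Real.cosh s * huu
    have e2 : b * u * u' * ((starRingEnd ℂ) (β i) * α i * (1 - w)) * a = Real.sinh s := by
      linear_combination b * u' * ((starRingEnd ℂ) (β i) * α i * (1 - w)) * huu -
        u' * ((starRingEnd ℂ) (β i) * α i) * hw' - u' * h2' + Real.sinh s * huu'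
    rw [e1, e2]
  have h3 : σ k ≠ i := fun h => hkj (by rw [← h, hσ])
  have h4 : σ k ≠ σ i := fun h => hki (hσ.injective h)
  rw [boost_mulVec_of_ne _ _ hki hkj, crossMat_mulVec]
  simp [hki, hkj, h3, h4]

end IsCrossUnitary

end CrossMatrices

section Generation

variable {n : ℕ}

/-- The diagonal matrix with entries `1, -1, 1, -1, …`. -/
def altSign (n : ℕ) : Matrix (Fin n) (Fin n) ℂ :=
  Matrix.diagonal fun k => (-1) ^ (k : ℕ)

/-- The quadratic form of signature `+, -, +, -, …`. -/
noncomputable def signForm (v : Fin n → ℂ) : ℝ :=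
  ∑ j : Fin n, (-1) ^ (j : ℕ) * ‖v j‖ ^ 2

lemma signForm_eq_dotProduct (v : Fin n → ℂ) :
    (signForm v : ℂ) = star v ⬝ᵥ (altSign n *ᵥ v) := by
  simp only [signForm, altSign, dotProduct, Matrix.mulVec_diagonal, Pi.star_apply,
    Complex.star_def, Complex.ofReal_sum]
  refine Finset.sum_congr rfl fun j _ => ?_
  push_cast
  rw [← Complex.conj_mul']
  ring

lemma star_mulVec_dotProduct {g : Matrix (Fin n) (Fin n) ℂ}
    (hg : gᴴ * altSign n * g = altSign n) (v w : Fin n → ℂ) :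
    star (g *ᵥ v) ⬝ᵥ (altSign n *ᵥ (g *ᵥ w)) = star v ⬝ᵥ (altSign n *ᵥ w) := by
  rw [Matrix.star_mulVec, ← Matrix.dotProduct_mulVec, Matrix.mulVec_mulVec, Matrix.mulVec_mulVec,
    hg]

lemma signForm_mulVec {g : Matrix (Fin n) (Fin n) ℂ} (hg : gᴴ * altSign n * g = altSign n)
    (v : Fin n → ℂ) : signForm (g *ᵥ v) = signForm v := by
  have := star_mulVec_dotProduct hg v v
  rw [← signForm_eq_dotProduct, ← signForm_eq_dotProduct] at this
  exact_mod_cast this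

lemma mulVec_apply_of_fixes {g : Matrix (Fin n) (Fin n) ℂ} (hg : gᴴ * altSign n * g = altSign n)
    {j : Fin n} (hj : g *ᵥ Pi.single j 1 = Pi.single j 1) (v : Fin n → ℂ) :
    (g *ᵥ v) j = v j := by
  have h := star_mulVec_dotProduct hg (Pi.single j 1) v
  rw [hj] at h
  simpa [altSign, Matrix.mulVec_diagonal, -Matrix.mulVec_mulVec, ← Pi.single_star] using h

/-- A submonoid of pseudo-unitary matrices, closed under left division, that contains the diagonal
unitary matrices and all boosts in two consecutive coordinates. -/
structure ContainsBoosts (N : Submonoid (Matrix (Fin n) (Fin n) ℂ)) : Prop where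
  isometry : ∀ g ∈ N, gᴴ * altSign n * g = altSign n
  of_mul_mem : ∀ g h, g ∈ N → g * h ∈ N → h ∈ N
  diagonal_mem : ∀ q : Fin n → ℂ, (∀ k, ‖q k‖ = 1) → Matrix.diagonal q ∈ N
  boost_mem : ∀ (k : ℕ) (hk : k + 1 < n) (s : ℝ), boost ⟨k, by omega⟩ ⟨k + 1, hk⟩ s ∈ N

/-- The elements of `N` that fix every basis vector of index greater than `k`. -/
def fixTail (N : Submonoid (Matrix (Fin n) (Fin n) ℂ)) (k : ℕ) :
    Submonoid (Matrix (Fin n) (Fin n) ℂ) where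
  carrier := {g | g ∈ N ∧ ∀ j : Fin n, k < j → g *ᵥ Pi.single j 1 = Pi.single j 1}
  one_mem' := ⟨N.one_mem, fun j _ => Matrix.one_mulVec _⟩
  mul_mem' := fun {g h} hg hh => ⟨N.mul_mem hg.1 hh.1, fun j hj => by
    rw [← Matrix.mulVec_mulVec, hh.2 j hj, hg.2 j hj]⟩

variable {N : Submonoid (Matrix (Fin n) (Fin n) ℂ)}

lemma fixTail_mono {k l : ℕ} (hkl : k ≤ l) : fixTail N k ≤ fixTail N l :=
  fun _ hg => ⟨hg.1, fun j hj => hg.2 j (hkl.trans_lt hj)⟩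

namespace ContainsBoosts

lemma mulVec_apply (hN : ContainsBoosts N) {k : ℕ} {g : Matrix (Fin n) (Fin n) ℂ}
    (hg : g ∈ fixTail N k) {j : Fin n} (hj : k < j) (v : Fin n → ℂ) : (g *ᵥ v) j = v j :=
  mulVec_apply_of_fixes (hN.isometry g hg.1) (hg.2 j hj) v

lemma boost_mem_fixTail (hN : ContainsBoosts N) {k : ℕ} (hk : k + 1 < n) (s : ℝ) :
    boost ⟨k, by omega⟩ ⟨k + 1, hk⟩ s ∈ fixTail N (k + 1) := by
  refine ⟨hN.boost_mem k hk s, fun j hj => ?_⟩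
  ext l
  have h1 : (⟨k, by omega⟩ : Fin n) ≠ j := Fin.ne_of_val_ne (by simp; omega)
  have h2 : (⟨k + 1, hk⟩ : Fin n) ≠ j := Fin.ne_of_val_ne hj.ne
  by_cases hl : l = ⟨k, by omega⟩
  · subst hl
    rw [boost_mulVec_left]
    simp [h1, h2]
  by_cases hl' : l = ⟨k + 1, hk⟩
  · subst hl'
    rw [boost_mulVec_right]
    simp [h1, h2]
  exact boost_mulVec_of_ne _ _ hl hl'

lemma exists_phase (hN : ContainsBoosts N) (k : Fin n) (a : ℂ) :
    ∃ u : ℂ, u * a = ‖a‖ ∧ Matrix.diagonal (Function.update 1 k u) ∈ fixTail N k := by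
  obtain ⟨u, hu, h⟩ : ∃ u : ℂ, ‖u‖ = 1 ∧ u * a = ‖a‖ := by
    by_cases ha : a = 0
    · exact ⟨1, by simp, by simp [ha]⟩
    · have h0 : ‖a‖ ≠ 0 := norm_ne_zero_iff.2 ha
      refine ⟨‖a‖ / a, by simp [h0], div_mul_cancel₀ _ ha⟩
  refine ⟨u, h, hN.diagonal_mem _ fun j => ?_, fun j hj => ?_⟩
  · by_cases hj : j = k
    · subst hj; simpa using hu
    · simp [hj]
  · have hj' : j ≠ k := by rintro rfl; exact lt_irrefl _ hj
    ext l
    rw [Matrix.mulVec_diagonal]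
    by_cases hl : l = k
    · subst hl; simp [hj'.symm]
    · simp [hl]

lemma exists_apply_ne_zero (hN : ContainsBoosts N) (k : ℕ) (hk : k < n) (v : Fin n → ℂ)
    (hv : ∀ j : Fin n, k < j → v j = 0) (hv0 : v ≠ 0) :
    ∃ h ∈ fixTail N k, (h *ᵥ v) ⟨k, hk⟩ ≠ 0 := by
  induction k with
  | zero =>
    refine ⟨1, one_mem _, fun h0 => hv0 ?_⟩
    rw [Matrix.one_mulVec] at h0
    ext j
    rcases Nat.eq_zero_or_pos j with hj | hj
    · rwa [show j = ⟨0, hk⟩ from Fin.ext hj]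
    · exact hv j hj
  | succ k ih =>
    by_cases h0 : v ⟨k + 1, hk⟩ = 0
    · have hv' : ∀ j : Fin n, k < j → v j = 0 := fun j hj => by
        rcases (Nat.succ_le_of_lt hj).eq_or_lt with h | h
        · rwa [show j = ⟨k + 1, hk⟩ from Fin.ext h.symm]
        · exact hv j h
      obtain ⟨h, hh, hne⟩ := ih (by omega) hv'
      refine ⟨_, mul_mem (hN.boost_mem_fixTail hk 1) (fixTail_mono (Nat.le_succ k) hh), ?_⟩
      rw [← Matrix.mulVec_mulVec, boost_mulVec_right, hN.mulVec_apply hh (by simp), h0, mul_zero,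
        zero_add]
      refine mul_ne_zero ?_ hne
      exact_mod_cast (Real.sinh_pos_iff.2 one_pos).ne'
    · exact ⟨1, one_mem _, by rwa [Matrix.one_mulVec]⟩

lemma exists_lt_norm_sq (hN : ContainsBoosts N) {k : ℕ} (hk : k + 1 < n) (v : Fin n → ℂ)
    (hv0 : v ⟨k + 1, hk⟩ ≠ 0) {c : ℝ} (hc : 0 < c) :
    ∃ h ∈ fixTail N (k + 1), c < ‖(h *ᵥ v) ⟨k + 1, hk⟩‖ ^ 2 := by
  set a := v ⟨k, by omega⟩ with ha
  set b := v ⟨k + 1, hk⟩ with hb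
  have hb0 : 0 < ‖b‖ ^ 2 := by positivity
  obtain ⟨s, hs⟩ := Real.sinh_surjective (Real.sqrt (c / ‖b‖ ^ 2))
  have hs2 : Real.sinh s ^ 2 * ‖b‖ ^ 2 = c := by
    rw [hs, Real.sq_sqrt (by positivity), div_mul_cancel₀ _ hb0.ne']
  have hbig : c < ‖Real.cosh s * b‖ ^ 2 := by
    rw [norm_mul, mul_pow, Complex.norm_real, Real.norm_eq_abs, sq_abs, Real.cosh_sq]
    nlinarith
  have hpar := parallelogram_law_with_norm ℝ (Real.cosh s * b) (Real.sinh s * a)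
  have hor : c < ‖Real.cosh s * b + Real.sinh s * a‖ ^ 2 ∨
      c < ‖Real.cosh s * b - Real.sinh s * a‖ ^ 2 := by
    by_contra! hcon
    nlinarith [mul_self_nonneg ‖(Real.sinh s * a : ℂ)‖]
  rcases hor with h | h
  · exact ⟨_, hN.boost_mem_fixTail hk s, by rwa [boost_mulVec_right]⟩
  · refine ⟨_, hN.boost_mem_fixTail hk (-s), ?_⟩
    rw [boost_mulVec_right, Real.cosh_neg, Real.sinh_neg]
    push_cast at h ⊢
    rwa [neg_mul, ← sub_eq_add_neg]

lemma signForm_eq_update_add (k : Fin n) (v : Fin n → ℂ) :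
    signForm v = signForm (Function.update v k 0) + (-1) ^ (k : ℕ) * ‖v k‖ ^ 2 := by
  have h : ∑ j ∈ Finset.univ.erase k, (-1 : ℝ) ^ (j : ℕ) * ‖Function.update v k 0 j‖ ^ 2 =
      ∑ j ∈ Finset.univ.erase k, (-1) ^ (j : ℕ) * ‖v j‖ ^ 2 :=
    Finset.sum_congr rfl fun j hj => by rw [Function.update_of_ne (Finset.ne_of_mem_erase hj)]
  unfold signForm
  rw [← Finset.add_sum_erase _ _ (Finset.mem_univ k), ← Finset.add_sum_erase _ (fun j : Fin n =>
    (-1) ^ (j : ℕ) * ‖Function.update v k 0 j‖ ^ 2) (Finset.mem_univ k), h]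
  simp [add_comm]

/-- Vectors supported on the first `k + 1` coordinates and having the same sign of the form as the
`k`-th basis vector can be moved to a multiple of that basis vector. -/
lemma exists_mulVec_eq_single (hN : ContainsBoosts N) (k : ℕ) (hk : k < n) (v : Fin n → ℂ)
    (hv : ∀ j : Fin n, k < j → v j = 0) {c : ℝ} (hc : 0 < c)
    (hvc : signForm v = (-1) ^ k * c) :
    ∃ h ∈ fixTail N k, h *ᵥ v = Pi.single ⟨k, hk⟩ (Real.sqrt c : ℂ) := by
  induction k generalizing v c with
  | zero =>
    obtain ⟨u, hu, hD⟩ := hN.exists_phase ⟨0, hk⟩ (v ⟨0, hk⟩)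
    refine ⟨_, hD, ?_⟩
    have hv0 : Function.update v ⟨0, hk⟩ 0 = 0 := by
      ext j
      rcases Nat.eq_zero_or_pos j with hj | hj
      · simp [show j = ⟨0, hk⟩ from Fin.ext hj]
      · rw [Function.update_of_ne (by rintro rfl; simp at hj), hv j hj, Pi.zero_apply]
    rw [signForm_eq_update_add ⟨0, hk⟩, hv0] at hvc
    have hnorm : ‖v ⟨0, hk⟩‖ = Real.sqrt c := by
      rw [← Real.sqrt_sq (norm_nonneg _)]
      congr 1
      simpa [signForm] using hvc
    ext j
    rw [Matrix.mulVec_diagonal]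
    by_cases hj : j = ⟨0, hk⟩
    · subst hj; simp [hu, hnorm]
    · have : 0 < (j : ℕ) := Nat.pos_of_ne_zero fun h => hj (Fin.ext h)
      simp [hj, hv j this]
  | succ k ih =>
    have hk' : k < n := by omega
    have hne : (⟨k, hk'⟩ : Fin n) ≠ ⟨k + 1, hk⟩ := by simp
    have hv0 : v ≠ 0 := by
      rintro rfl
      have : (0 : ℝ) = (-1) ^ (k + 1) * c := by rw [← hvc]; simp [signForm]
      exact mul_ne_zero (pow_ne_zero _ (by norm_num)) hc.ne' this.symm
    obtain ⟨h₁, hh₁, hne₁⟩ := hN.exists_apply_ne_zero (k + 1) hk v hv hv0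
    obtain ⟨h₂, hh₂, hlt⟩ := hN.exists_lt_norm_sq hk _ hne₁ hc
    have hh := mul_mem hh₂ hh₁
    rw [Matrix.mulVec_mulVec] at hlt
    set x := (h₂ * h₁) *ᵥ v with hx
    have hxform : signForm x = (-1) ^ (k + 1) * c := by
      rw [hx, signForm_mulVec (hN.isometry _ hh.1), hvc]
    have hxsupp : ∀ j : Fin n, k + 1 < j → x j = 0 := fun j hj => by
      rw [hx, hN.mulVec_apply hh hj, hv j hj]
    set b := x ⟨k + 1, hk⟩ with hb
    set y := Function.update x ⟨k + 1, hk⟩ 0 with hy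
    have hyform : signForm y = (-1) ^ k * (‖b‖ ^ 2 - c) := by
      have := signForm_eq_update_add ⟨k + 1, hk⟩ x
      rw [hxform, pow_succ] at this
      linear_combination -this
    have hysupp : ∀ j : Fin n, k < j → y j = 0 := fun j hj => by
      rcases (Nat.succ_le_of_lt hj).eq_or_lt with h | h
      · rw [show j = ⟨k + 1, hk⟩ from Fin.ext h.symm]; simp [hy]
      · rw [hy, Function.update_of_ne (by rintro rfl; simp at h), hxsupp j h]
    obtain ⟨h₃, hh₃, hy₃⟩ := ih hk' y hysupp (sub_pos.2 hlt) hyform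
    obtain ⟨u, hu, hh₄⟩ := hN.exists_phase ⟨k + 1, hk⟩ b
    have hxy : x = y + b • Pi.single ⟨k + 1, hk⟩ 1 := by
      ext j
      by_cases hj : j = ⟨k + 1, hk⟩
      · subst hj; simp [hy, hb]
      · simp [hy, hj]
    have hx₃ : h₃ *ᵥ x = Pi.single ⟨k, hk'⟩ (Real.sqrt (‖b‖ ^ 2 - c) : ℂ) +
        b • Pi.single ⟨k + 1, hk⟩ 1 := by
      rw [hxy, Matrix.mulVec_add, Matrix.mulVec_smul, hy₃, hh₃.2 ⟨k + 1, hk⟩ (by simp)]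
    set w := Matrix.diagonal (Function.update 1 ⟨k + 1, hk⟩ u) *ᵥ (h₃ *ᵥ x) with hw
    have hwk : w ⟨k, hk'⟩ = Real.sqrt (‖b‖ ^ 2 - c) := by
      rw [hw, Matrix.mulVec_diagonal, hx₃]
      simp
    have hwk' : w ⟨k + 1, hk⟩ = ‖b‖ := by
      rw [hw, Matrix.mulVec_diagonal, hx₃]
      simp [hu]
    have hwj : ∀ j, j ≠ ⟨k, hk'⟩ → j ≠ ⟨k + 1, hk⟩ → w j = 0 := fun j h1 h2 => by
      rw [hw, Matrix.mulVec_diagonal, hx₃]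
      simp [h1, h2]
    have hd : Real.sqrt (‖b‖ ^ 2 - c) ^ 2 = ‖b‖ ^ 2 - c := Real.sq_sqrt (sub_pos.2 hlt).le
    have hsc : Real.sqrt c ^ 2 = c := Real.sq_sqrt hc.le
    have hsc0 : 0 < Real.sqrt c := Real.sqrt_pos.2 hc
    set d := Real.sqrt (‖b‖ ^ 2 - c)
    set e := Real.sqrt c
    obtain ⟨s, hs⟩ := Real.sinh_surjective (-d / e)
    have hcosh : Real.cosh s = ‖b‖ / e := by
      rw [← sq_eq_sq₀ (Real.cosh_pos s).le (by positivity), Real.cosh_sq, hs]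
      field_simp
      linarith
    refine ⟨_, mul_mem (hN.boost_mem_fixTail hk s)
      (mul_mem hh₄ (mul_mem (fixTail_mono (Nat.le_succ k) hh₃) hh)), ?_⟩
    rw [← Matrix.mulVec_mulVec, ← Matrix.mulVec_mulVec, ← Matrix.mulVec_mulVec, ← hx, ← hw]
    have he0 : (e : ℂ) ≠ 0 := by exact_mod_cast hsc0.ne'
    ext j
    by_cases h1 : j = ⟨k, hk'⟩
    · subst h1
      rw [boost_mulVec_left, hwk, hwk', hs, hcosh, Pi.single_eq_of_ne hne]
      push_cast
      ring
    by_cases h2 : j = ⟨k + 1, hk⟩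
    · subst h2
      rw [boost_mulVec_right, hwk, hwk', hs, hcosh, Pi.single_eq_same]
      have : (‖b‖ / e * ‖b‖ + -d / e * d : ℝ) = e := by
        field_simp
        linarith
      exact_mod_cast this
    · rw [boost_mulVec_of_ne _ _ h1 h2, hwj j h1 h2, Pi.single_eq_of_ne h2]

lemma mem_of_fixes (hN : ContainsBoosts N) (k : ℕ) (hk : k ≤ n) (g : Matrix (Fin n) (Fin n) ℂ)
    (hg : gᴴ * altSign n * g = altSign n)
    (hfix : ∀ j : Fin n, k ≤ j → g *ᵥ Pi.single j 1 = Pi.single j 1) : g ∈ N := by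
  induction k generalizing g with
  | zero =>
    rw [show g = 1 from Matrix.ext_of_mulVec_single fun j => by
      rw [hfix j (Nat.zero_le _), Matrix.one_mulVec]]
    exact N.one_mem
  | succ k ih =>
    have hform : signForm (g *ᵥ Pi.single ⟨k, hk⟩ 1) = (-1) ^ k * 1 := by
      rw [signForm_mulVec hg, signForm_eq_update_add ⟨k, hk⟩]
      simp [signForm, Pi.single]
    obtain ⟨h, hh, hk1⟩ := hN.exists_mulVec_eq_single k hk (g *ᵥ Pi.single ⟨k, hk⟩ 1)
      (fun j hj => by
        rw [mulVec_apply_of_fixes hg (hfix j hj), Pi.single_eq_of_ne]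
        rintro rfl
        simp at hj) one_pos hform
    refine hN.of_mul_mem h g hh.1 (ih (by omega) _ ?_ fun j hj => ?_)
    · rw [Matrix.conjTranspose_mul]
      calc gᴴ * hᴴ * altSign n * (h * g) = gᴴ * (hᴴ * altSign n * h) * g := by
            simp only [Matrix.mul_assoc]
        _ = altSign n := by rw [hN.isometry h hh.1, hg]
    · rw [← Matrix.mulVec_mulVec]
      rcases hj.eq_or_lt with h | h
      · rw [show j = ⟨k, hk⟩ from Fin.ext h.symm, hk1]
        simp
      · rw [hfix j h, hh.2 j h]

theorem mem_of_isometry (hN : ContainsBoosts N) {g : Matrix (Fin n) (Fin n) ℂ}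
    (hg : gᴴ * altSign n * g = altSign n) : g ∈ N :=
  hN.mem_of_fixes n le_rfl g hg fun j hj => absurd j.isLt hj.not_gt

end ContainsBoosts

end Generation

section TransferMatrices

variable {M : ℕ} {r t : ℝ} {z : ℂ}

/-- The involution of the indices preserving the blocks of `M1mat`. -/
def blockSwap (M : ℕ) (k : Fin (2 * M)) : Fin (2 * M) :=
  ⟨if (k : ℕ) % 2 = 0 then k + 1 else k - 1, by have := k.isLt; split_ifs <;> omega⟩

/-- The involution of the indices preserving the blocks of `M2mat`. -/
def shiftedSwap (M : ℕ) (k : Fin (2 * M)) : Fin (2 * M) :=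
  ⟨if (k : ℕ) % 2 = 1 then (if (k : ℕ) + 1 = 2 * M then 0 else k + 1)
    else if (k : ℕ) = 0 then 2 * M - 1 else k - 1, by have := k.isLt; split_ifs <;> omega⟩

lemma blockSwap_involutive : Function.Involutive (blockSwap M) := by
  intro k
  ext
  simp only [blockSwap]
  split_ifs <;> omega

lemma shiftedSwap_involutive : Function.Involutive (shiftedSwap M) := by
  intro k
  have key : ∀ a : Fin (2 * M), (shiftedSwap M a : ℕ) = if (a : ℕ) % 2 = 1 then
      (if (a : ℕ) + 1 = 2 * M then 0 else (a : ℕ) + 1)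
      else if (a : ℕ) = 0 then 2 * M - 1 else a - 1 := fun _ => rfl
  have h1 := key k
  have h2 := key (shiftedSwap M k)
  ext
  split_ifs at h1 h2 <;> omega

lemma blockSwap_mod_two (k : Fin (2 * M)) : (blockSwap M k : ℕ) % 2 = 1 - (k : ℕ) % 2 := by
  simp only [blockSwap]
  split_ifs <;> omega

lemma shiftedSwap_mod_two (k : Fin (2 * M)) : (shiftedSwap M k : ℕ) % 2 = 1 - (k : ℕ) % 2 := by
  simp only [shiftedSwap]
  split_ifs <;> omega

/-- The diagonal coefficients of `M1mat`. -/
noncomputable def pairedDiag (M : ℕ) (t : ℝ) (z : ℂ) (k : Fin (2 * M)) : ℂ :=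
  (if (k : ℕ) % 2 = 0 then (starRingEnd ℂ) z else z) / t

/-- The diagonal coefficients of `M2mat`. -/
noncomputable def shiftedDiag (M : ℕ) (r : ℝ) (z : ℂ) (k : Fin (2 * M)) : ℂ :=
  (if (k : ℕ) % 2 = 1 then z else -(starRingEnd ℂ) z) / r

/-- The off-diagonal coefficients of `M2mat`. -/
noncomputable def shiftedOff (M : ℕ) (r t : ℝ) (k : Fin (2 * M)) : ℂ :=
  (if (k : ℕ) % 2 = 1 then -(t : ℂ) else t) / r

lemma crossMat_apply_of_ne {ι : Type*} [DecidableEq ι] {σ : ι → ι} {k l : ι}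
    (α β : ι → ℂ) (hσ : σ k ≠ k) :
    crossMat σ α β k l = if k = l then α k else if σ k = l then β k else 0 := by
  by_cases h : k = l
  · subst h; simp [crossMat, hσ]
  · simp [crossMat, h]

lemma M1mat_eq : M1mat M r t z =
    crossMat (blockSwap M) (pairedDiag M t z) (fun _ => -(r : ℂ) / t) := by
  ext a b
  have hne : blockSwap M a ≠ a := fun h => by
    have := blockSwap_mod_two a; rw [h] at this; omega
  have hval : (blockSwap M a : ℕ) = if (a : ℕ) % 2 = 0 then (a : ℕ) + 1 else a - 1 := rfl
  rw [crossMat_apply_of_ne _ _ hne]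
  simp only [M1mat, Matrix.of_apply, pairedDiag]
  by_cases h1 : a = b
  · simp [h1]
  · have h1' : (a : ℕ) ≠ b := fun h => h1 (Fin.ext h)
    have : (a : ℕ) / 2 = (b : ℕ) / 2 ↔ blockSwap M a = b := by
      rw [Fin.ext_iff, hval]
      split_ifs <;> omega
    simp only [this, h1, if_false]

lemma M2mat_eq : M2mat M r t z =
    crossMat (shiftedSwap M) (shiftedDiag M r z) (shiftedOff M r t) := by
  ext a b
  have hne : shiftedSwap M a ≠ a := fun h => by
    have := shiftedSwap_mod_two a; rw [h] at this; omega
  have hval : (shiftedSwap M a : ℕ) = if (a : ℕ) % 2 = 1 then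
      (if (a : ℕ) + 1 = 2 * M then 0 else (a : ℕ) + 1)
      else if (a : ℕ) = 0 then 2 * M - 1 else a - 1 := rfl
  have hmod : ∀ c : Fin (2 * M), ((c : ℕ) + 1) % (2 * M) =
      if (c : ℕ) + 1 = 2 * M then 0 else (c : ℕ) + 1 := fun c => by
    split_ifs with h
    · rw [h, Nat.mod_self]
    · exact Nat.mod_eq_of_lt (by omega)
  rw [crossMat_apply_of_ne _ _ hne]
  simp only [M2mat, Matrix.of_apply, shiftedDiag, shiftedOff]
  by_cases h1 : a = b
  · simp [h1]
  · have h1' : (a : ℕ) ≠ b := fun h => h1 (Fin.ext h)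
    have : ((a : ℕ) + 1) % (2 * M) / 2 = ((b : ℕ) + 1) % (2 * M) / 2 ↔ shiftedSwap M a = b := by
      rw [Fin.ext_iff, hval, hmod, hmod]
      split_ifs <;> omega
    simp only [this, h1, if_false]

lemma isCrossUnitary_block (hr : 0 < r) (ht : 0 < t) (hrt : r ^ 2 + t ^ 2 = 1) (hz : ‖z‖ = 1) :
    IsCrossUnitary (blockSwap M) (pairedDiag M t z) (fun _ => -(r : ℂ) / t) (1 / t ^ 2) := by
  have ht0 : (t : ℂ) ≠ 0 := by exact_mod_cast ht.ne'
  have hrt' : (r : ℂ) ^ 2 + (t : ℂ) ^ 2 = 1 := by exact_mod_cast hrt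
  have hzz : (starRingEnd ℂ) z * z = 1 := by rw [Complex.conj_mul', hz]; simp
  refine ⟨blockSwap_involutive, ?_, fun k => ?_, fun k => ?_, fun k => ?_⟩
  · rw [lt_div_iff₀ (by positivity)]
    nlinarith
  · simp only [pairedDiag]
    split_ifs <;> simp <;> field_simp <;> linear_combination hzz
  · simp
    field_simp
    linear_combination hrt'
  · simp only [pairedDiag, blockSwap_mod_two]
    rcases Nat.mod_two_eq_zero_or_one k with h | h <;> simp [h] <;> ring

lemma isCrossUnitary_shifted (hr : 0 < r) (ht : 0 < t) (hrt : r ^ 2 + t ^ 2 = 1) (hz : ‖z‖ = 1) :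
    IsCrossUnitary (shiftedSwap M) (shiftedDiag M r z) (shiftedOff M r t) (1 / r ^ 2) := by
  have hr0 : (r : ℂ) ≠ 0 := by exact_mod_cast hr.ne'
  have hrt' : (r : ℂ) ^ 2 + (t : ℂ) ^ 2 = 1 := by exact_mod_cast hrt
  have hzz : (starRingEnd ℂ) z * z = 1 := by rw [Complex.conj_mul', hz]; simp
  refine ⟨shiftedSwap_involutive, ?_, fun k => ?_, fun k => ?_, fun k => ?_⟩
  · rw [lt_div_iff₀ (by positivity)]
    nlinarith
  · simp only [shiftedDiag]
    split_ifs <;> simp <;> field_simp <;> linear_combination hzz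
  · simp only [shiftedOff]
    split_ifs <;> simp <;> field_simp <;> linear_combination hrt'
  · simp only [shiftedDiag, shiftedOff, shiftedSwap_mod_two]
    rcases Nat.mod_two_eq_zero_or_one k with h | h <;> simp [h] <;> ring

lemma JJ_eq_altSign : JJ M = altSign (2 * M) := by
  unfold JJ altSign
  congr 1
  ext k
  split_ifs with h
  · rw [(Nat.even_iff.2 h).neg_one_pow]
  · rw [(Nat.not_even_iff_odd.1 fun h' => h (Nat.even_iff.1 h')).neg_one_pow]

lemma neg_one_pow_of_mod_two {a b : ℕ} (h : a % 2 = 1 - b % 2) : (-1 : ℂ) ^ a = -(-1) ^ b := by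
  rw [neg_one_pow_eq_pow_mod_two, neg_one_pow_eq_pow_mod_two (n := b), h]
  rcases Nat.mod_two_eq_zero_or_one b with h | h <;> simp [h]

lemma isometry_mul {n : ℕ} {g h : Matrix (Fin n) (Fin n) ℂ} (hg : gᴴ * altSign n * g = altSign n)
    (hh : hᴴ * altSign n * h = altSign n) : (g * h)ᴴ * altSign n * (g * h) = altSign n := by
  rw [Matrix.conjTranspose_mul]
  calc hᴴ * gᴴ * altSign n * (g * h) = hᴴ * (gᴴ * altSign n * g) * h := by
        simp only [Matrix.mul_assoc]
    _ = altSign n := by rw [hg, hh]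

lemma isometry_diagonal {n : ℕ} {q : Fin n → ℂ} (hq : ∀ k, ‖q k‖ = 1) :
    (Matrix.diagonal q)ᴴ * altSign n * Matrix.diagonal q = altSign n := by
  rw [altSign, Matrix.diagonal_conjTranspose, Matrix.diagonal_mul_diagonal,
    Matrix.diagonal_mul_diagonal]
  congr 1
  ext k
  have : (starRingEnd ℂ) (q k) * q k = 1 := by rw [Complex.conj_mul', hq]; simp
  simp only [Pi.star_apply, Complex.star_def]
  linear_combination (-1) ^ (k : ℕ) * this

lemma isometry_Az (hr : 0 < r) (ht : 0 < t) (hrt : r ^ 2 + t ^ 2 = 1) (hz : ‖z‖ = 1)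
    {p : Fin (4 * M) → ℂ} (hp : ∀ i, ‖p i‖ = 1) :
    (Az M r t z p)ᴴ * altSign (2 * M) * Az M r t z p = altSign (2 * M) := by
  have h1 : (M1mat M r t z)ᴴ * altSign (2 * M) * M1mat M r t z = altSign (2 * M) := by
    rw [M1mat_eq]
    exact (isCrossUnitary_block hr ht hrt hz).conjTranspose_mul_mul
      fun k => neg_one_pow_of_mod_two (blockSwap_mod_two k)
  have h2 : (M2mat M r t z)ᴴ * altSign (2 * M) * M2mat M r t z = altSign (2 * M) := by
    rw [M2mat_eq]
    exact (isCrossUnitary_shifted hr ht hrt hz).conjTranspose_mul_mul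
      fun k => neg_one_pow_of_mod_two (shiftedSwap_mod_two k)
  refine isometry_mul (isometry_mul (isometry_mul (isometry_mul
    (isometry_diagonal fun k => ?_) h2) (isometry_diagonal fun k => hp _)) h1)
    (isometry_diagonal fun k => ?_)
  · unfold pL; split_ifs <;> simp [hp]
  · unfold pR; split_ifs <;> simp [hp]

lemma altSign_mul_self (n : ℕ) : altSign n * altSign n = 1 := by
  rw [altSign, Matrix.diagonal_mul_diagonal, ← Matrix.diagonal_one]
  congr 1
  ext k
  rw [← mul_pow]
  simp

lemma exists_unit_of_isometry {n : ℕ} {g : Matrix (Fin n) (Fin n) ℂ}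
    (hg : gᴴ * altSign n * g = altSign n) : ∃ u : GL (Fin n) ℂ, (u : Matrix _ _ ℂ) = g := by
  have h : altSign n * gᴴ * altSign n * g = 1 := by
    rw [Matrix.mul_assoc, Matrix.mul_assoc, ← Matrix.mul_assoc gᴴ, hg, altSign_mul_self]
  exact ⟨⟨g, altSign n * gᴴ * altSign n, mul_eq_one_comm.1 h, h⟩, rfl⟩

/-- The group of invertible matrices preserving the form of signature `+, -, +, -, …`. -/
def isometryGroup (n : ℕ) : Subgroup (GL (Fin n) ℂ) where
  carrier := {g | (g : Matrix (Fin n) (Fin n) ℂ)ᴴ * altSign n * (g : Matrix (Fin n) (Fin n) ℂ) =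
    altSign n}
  one_mem' := by simp
  mul_mem' hg hh := isometry_mul hg hh
  inv_mem' {g} hg := by
    have h1 : (g : Matrix (Fin n) (Fin n) ℂ) * (g⁻¹ : GL (Fin n) ℂ) = 1 := Units.mul_inv g
    have h2 : ((g⁻¹ : GL (Fin n) ℂ) : Matrix (Fin n) (Fin n) ℂ)ᴴ *
        (g : Matrix (Fin n) (Fin n) ℂ)ᴴ = 1 := by
      rw [← Matrix.conjTranspose_mul, h1, Matrix.conjTranspose_one]
    simp only [Set.mem_ofPred_eq] at hg ⊢
    nth_rewrite 1 [← hg]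
    simp only [Matrix.mul_assoc, h1, Matrix.mul_one]
    rw [← Matrix.mul_assoc, h2, Matrix.one_mul]

lemma isClosed_isometryGroup (n : ℕ) : IsClosed (isometryGroup n : Set (GL (Fin n) ℂ)) := by
  have hc : Continuous fun g : GL (Fin n) ℂ => (g : Matrix (Fin n) (Fin n) ℂ) :=
    Units.continuous_val
  exact isClosed_eq ((hc.matrix_conjTranspose.matrix_mul continuous_const).matrix_mul hc)
    continuous_const

/-- The subgroup generated by the transfer matrices. -/
def transferGroup (M : ℕ) (r t : ℝ) (z : ℂ) : Subgroup (GL (Fin (2 * M)) ℂ) :=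
  Subgroup.closure {g : GL (Fin (2 * M)) ℂ |
    ∃ p : Fin (4 * M) → ℂ, (∀ i, ‖p i‖ = 1) ∧
      (g : Matrix (Fin (2 * M)) (Fin (2 * M)) ℂ) = Az M r t z p}

lemma transferGroup_le (hr : 0 < r) (ht : 0 < t) (hrt : r ^ 2 + t ^ 2 = 1) (hz : ‖z‖ = 1) :
    transferGroup M r t z ≤ isometryGroup (2 * M) := by
  refine (Subgroup.closure_le _).2 ?_
  rintro g ⟨p, hp, hg⟩
  change (g : Matrix _ _ ℂ)ᴴ * altSign (2 * M) * (g : Matrix _ _ ℂ) = altSign (2 * M)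
  rw [hg]
  exact isometry_Az hr ht hrt hz hp

lemma mem_map_coeHom_of_mul_left {R : Type*} [Monoid R] {G : Subgroup Rˣ} {a b : R}
    (ha : a ∈ G.toSubmonoid.map (Units.coeHom R))
    (hab : a * b ∈ G.toSubmonoid.map (Units.coeHom R)) :
    b ∈ G.toSubmonoid.map (Units.coeHom R) := by
  obtain ⟨u, hu, rfl⟩ := ha
  obtain ⟨v, hv, huv⟩ := hab
  refine ⟨u⁻¹ * v, G.mul_mem (G.inv_mem hu) hv, ?_⟩
  rw [map_mul, huv, Units.coeHom_apply, Units.coeHom_apply, Units.inv_mul_cancel_left]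

lemma mem_map_coeHom_of_mul_right {R : Type*} [Monoid R] {G : Subgroup Rˣ} {a b : R}
    (hb : b ∈ G.toSubmonoid.map (Units.coeHom R))
    (hab : a * b ∈ G.toSubmonoid.map (Units.coeHom R)) :
    a ∈ G.toSubmonoid.map (Units.coeHom R) := by
  obtain ⟨u, hu, rfl⟩ := hb
  obtain ⟨v, hv, huv⟩ := hab
  refine ⟨v * u⁻¹, G.mul_mem hv (G.inv_mem hu), ?_⟩
  rw [map_mul, huv, Units.coeHom_apply, Units.coeHom_apply, Units.mul_inv_cancel_right]

lemma containsBoosts_transferGroup (hr : 0 < r) (ht : 0 < t) (hrt : r ^ 2 + t ^ 2 = 1)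
    (hz : ‖z‖ = 1) :
    ContainsBoosts ((transferGroup M r t z).toSubmonoid.map
      (Units.coeHom (Matrix (Fin (2 * M)) (Fin (2 * M)) ℂ))) := by
  set N := (transferGroup M r t z).toSubmonoid.map
    (Units.coeHom (Matrix (Fin (2 * M)) (Fin (2 * M)) ℂ))
  have hgen : ∀ u m : Fin (2 * M) → ℂ, (∀ k, ‖u k‖ = 1) → (∀ k, ‖m k‖ = 1) →
      Matrix.diagonal (fun k : Fin (2 * M) => if (k : ℕ) % 2 = 0 then u k else 1) * M2mat M r t z *
        Matrix.diagonal m * M1mat M r t z *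
        Matrix.diagonal (fun k : Fin (2 * M) => if (k : ℕ) % 2 = 0 then 1 else u k) ∈ N := by
    intro u m hu hm
    let p : Fin (4 * M) → ℂ := fun i =>
      if h : (i : ℕ) < 2 * M then u ⟨i, h⟩ else m ⟨i - 2 * M, by omega⟩
    have hp : ∀ i, ‖p i‖ = 1 := fun i => by
      simp only [p]
      split_ifs
      · exact hu _
      · exact hm _
    obtain ⟨g, hg⟩ := exists_unit_of_isometry (isometry_Az hr ht hrt hz hp)
    refine ⟨g, Subgroup.subset_closure ⟨p, hp, hg⟩, ?_⟩
    have hL : pL M p = fun k : Fin (2 * M) => if (k : ℕ) % 2 = 0 then u k else 1 := by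
      ext k; simp [pL, p]
    have hR : pR M p = fun k : Fin (2 * M) => if (k : ℕ) % 2 = 0 then 1 else u k := by
      ext k; simp [pR, p]
    have hMid : pM M p = m := by
      ext k; simp [pM, p]
    rw [Units.coeHom_apply, hg, Az, Dmat, Dmat, Dmat, hL, hR, hMid]
  have h11 : ∀ k : Fin (2 * M), ‖(1 : Fin (2 * M) → ℂ) k‖ = 1 := by simp
  have hbase : M2mat M r t z * M1mat M r t z ∈ N := by
    simpa using hgen 1 1 h11 h11
  have hdiag : ∀ q : Fin (2 * M) → ℂ, (∀ k, ‖q k‖ = 1) → Matrix.diagonal q ∈ N := by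
    intro q hq
    have heven :
        Matrix.diagonal (fun k : Fin (2 * M) => if (k : ℕ) % 2 = 0 then q k else 1) ∈ N := by
      refine mem_map_coeHom_of_mul_right hbase ?_
      change _ ∈ N
      have := hgen (fun k => if (k : ℕ) % 2 = 0 then q k else 1) 1
        (fun k => by split_ifs <;> simp [hq]) h11
      simpa +contextual [Matrix.mul_assoc] using this
    have hodd :
        Matrix.diagonal (fun k : Fin (2 * M) => if (k : ℕ) % 2 = 0 then 1 else q k) ∈ N := by
      refine mem_map_coeHom_of_mul_left hbase ?_
      change _ ∈ N
      have := hgen (fun k => if (k : ℕ) % 2 = 0 then 1 else q k) 1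
        (fun k => by split_ifs <;> simp [hq]) h11
      simpa +contextual [Matrix.mul_assoc] using this
    have := N.mul_mem heven hodd
    rw [Matrix.diagonal_mul_diagonal] at this
    refine (congrArg (· ∈ N) (congrArg Matrix.diagonal (funext fun k => ?_))).mp this
    split_ifs <;> simp
  have hmid : ∀ q : Fin (2 * M) → ℂ, (∀ k, ‖q k‖ = 1) →
      M2mat M r t z * Matrix.diagonal q * M1mat M r t z ∈ N := fun q hq => by
    simpa using hgen 1 q h11 hq
  have hB := isCrossUnitary_block (M := M) hr ht hrt hz
  have hS := isCrossUnitary_shifted (M := M) hr ht hrt hz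
  refine ⟨?_, fun g h => mem_map_coeHom_of_mul_left, hdiag, fun k hk s => ?_⟩
  · rintro _ ⟨g, hg, rfl⟩
    exact transferGroup_le hr ht hrt hz hg
  rcases Nat.mod_two_eq_zero_or_one k with h | h
  · have hsw : blockSwap M ⟨k, by omega⟩ = ⟨k + 1, hk⟩ := by simp [blockSwap, h]
    rw [← hsw]
    refine hB.boost_mem hdiag (fun q hq => ?_) (by rw [hsw]; simp) s
    refine mem_map_coeHom_of_mul_left hbase ?_
    have hinv := mul_eq_one_comm.1 hB.inv_mul
    rw [← M1mat_eq] at hinv ⊢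
    rw [show ∀ a b c d e : Matrix (Fin (2 * M)) (Fin (2 * M)) ℂ,
      a * b * (c * d * e) = a * (b * c) * d * e by intros; simp only [Matrix.mul_assoc],
      hinv, Matrix.mul_one]
    exact hmid q hq
  · have hsw : shiftedSwap M ⟨k, by omega⟩ = ⟨k + 1, hk⟩ := by
      simp [shiftedSwap, h, hk.ne]
    rw [← hsw]
    refine hS.inv_coeff.boost_mem hdiag (fun q hq => ?_) (by rw [hsw]; simp) s
    refine mem_map_coeHom_of_mul_right hbase ?_
    have hinv := hS.inv_mul
    rw [IsCrossUnitary.inv] at hinv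
    rw [hS.inv_inv_coeff]
    rw [← M2mat_eq] at hinv ⊢
    rw [show ∀ a b c d e : Matrix (Fin (2 * M)) (Fin (2 * M)) ℂ,
      a * b * c * (d * e) = a * b * (c * d) * e by intros; simp only [Matrix.mul_assoc],
      hinv, Matrix.mul_one]
    exact hmid q hq

lemma transferGroup_eq (hr : 0 < r) (ht : 0 < t) (hrt : r ^ 2 + t ^ 2 = 1) (hz : ‖z‖ = 1) :
    transferGroup M r t z = isometryGroup (2 * M) := by
  refine le_antisymm (transferGroup_le hr ht hrt hz) fun g hg => ?_
  obtain ⟨g', hg', h⟩ := (containsBoosts_transferGroup hr ht hrt hz).mem_of_isometry hg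
  rwa [← Units.ext h]

end TransferMatrices

/-- Fix `z ∈ 𝕋`.  Every transfer matrix `A_z(p)`, `p ∈ 𝕋^{4M}`, belongs to
`U_M(1,1) = {B : Bᴴ 𝕁 B = 𝕁}`, and the topological closure in `GL_{2M}(ℂ)` of the subgroup
generated by `{A_z(p) : p ∈ 𝕋^{4M}}` is exactly `U_M(1,1)`. -/
theorem stmt_9 (M : ℕ) (hM : 1 ≤ M) (r t : ℝ) (hr : r ∈ Set.Ioo (0 : ℝ) 1)
    (ht : t ∈ Set.Ioo (0 : ℝ) 1) (hrt : r ^ 2 + t ^ 2 = 1) (z : ℂ) (hz : ‖z‖ = 1) :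
    (∀ p : Fin (4 * M) → ℂ, (∀ i, ‖p i‖ = 1) →
      (Az M r t z p)ᴴ * JJ M * Az M r t z p = JJ M) ∧
    closure
        (↑(Subgroup.closure {g : GL (Fin (2 * M)) ℂ |
            ∃ p : Fin (4 * M) → ℂ, (∀ i, ‖p i‖ = 1) ∧
              (g : Matrix (Fin (2 * M)) (Fin (2 * M)) ℂ) = Az M r t z p}) :
          Set (GL (Fin (2 * M)) ℂ))
      = {g : GL (Fin (2 * M)) ℂ |
          (g : Matrix (Fin (2 * M)) (Fin (2 * M)) ℂ)ᴴ * JJ M *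
            (g : Matrix (Fin (2 * M)) (Fin (2 * M)) ℂ) = JJ M} := by
  rw [JJ_eq_altSign]
  refine ⟨fun p hp => isometry_Az hr.1 ht.1 hrt hz hp, ?_⟩
  change closure (transferGroup M r t z : Set (GL (Fin (2 * M)) ℂ)) =
    (isometryGroup (2 * M) : Set (GL (Fin (2 * M)) ℂ))
  rw [transferGroup_eq hr.1 ht.1 hrt hz, (isClosed_isometryGroup _).closure_eq]
end

section
/- Assume rt ≠ 0 and let M ≥ 1. Let U be the Chalker–Coddington unitary operator on ℓ²(ℤ × ℤ/2Mℤ) associated with an arbitrary configuration p of phases. Then the vectors e_{(0,k)}, k ∈ ℤ/2Mℤ, span a cyclic subspace for U: the closed linear span of {Uⁿ e_{(0,k)} : n ∈ ℤ, k ∈ ℤ/2Mℤ} is all of ℓ²(ℤ × ℤ/2Mℤ). Equivalently, the smallest closed subspace containing {e_{(0,k)} : k ∈ ℤ/2Mℤ} and invariant under both U and U^{−1} is the whole space. -/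
noncomputable section

/-- `ℓ²(ℤ × ℤ/2Mℤ)` with complex coefficients. -/
abbrev Hcyl (M : ℕ) : Type := lp (fun _ : ℤ × ZMod (2 * M) => ℂ) 2

/-- The canonical basis vector `e_μ` of `ℓ²(ℤ × ℤ/2Mℤ)`. -/
def e (M : ℕ) (μ : ℤ × ZMod (2 * M)) : Hcyl M := lp.single 2 μ 1

/-- Entry `S(q)₀₀ = q₁ q₂ t q₃` of `S(q) = diag(q₁q₂, q₁q̄₂)·[[t,−r],[r,t]]·diag(q₃, q̄₃)`. -/
def S00 (r t : ℝ) (q : ℂ × ℂ × ℂ) : ℂ := q.1 * q.2.1 * (t : ℂ) * q.2.2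
/-- Entry `S(q)₀₁ = −q₁ q₂ r q̄₃`. -/
def S01 (r t : ℝ) (q : ℂ × ℂ × ℂ) : ℂ := -(q.1 * q.2.1 * (r : ℂ) * (starRingEnd ℂ) q.2.2)
/-- Entry `S(q)₁₀ = q₁ q̄₂ r q₃`. -/
def S10 (r t : ℝ) (q : ℂ × ℂ × ℂ) : ℂ := q.1 * (starRingEnd ℂ) q.2.1 * (r : ℂ) * q.2.2
/-- Entry `S(q)₁₁ = q₁ q̄₂ t q̄₃`. -/
def S11 (r t : ℝ) (q : ℂ × ℂ × ℂ) : ℂ :=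
  q.1 * (starRingEnd ℂ) q.2.1 * (t : ℂ) * (starRingEnd ℂ) q.2.2

end

/-- A scattering matrix with unit phases has nonzero entries. -/
lemma scattering_entries_ne_zero {r t : ℝ} (hr : r ≠ 0) (ht : t ≠ 0) {q : ℂ × ℂ × ℂ}
    (hq : ‖q.1‖ = 1 ∧ ‖q.2.1‖ = 1 ∧ ‖q.2.2‖ = 1) :
    S00 r t q ≠ 0 ∧ S01 r t q ≠ 0 ∧ S10 r t q ≠ 0 ∧ S11 r t q ≠ 0 := by
  have unit_ne_zero {z : ℂ} (hz : ‖z‖ = 1) : z ≠ 0 := norm_ne_zero_iff.mp (by simp [hz])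
  simp [S00, S01, S10, S11, hr, ht, unit_ne_zero hq.1, unit_ne_zero hq.2.1, unit_ne_zero hq.2.2]

/-- If a subspace is invariant under `U` and `U⁻¹`, and `U` maps `x, y` to combinations of `u, v`,
then knowing one input `x` and one output `v` determines the other two vectors. -/
lemma Submodule.mem_of_scattering {E : Type*} [NormedAddCommGroup E] [NormedSpace ℂ E]
    {V : Submodule ℂ E} {U : E ≃ₗᵢ[ℂ] E} (hU : ∀ x ∈ V, U x ∈ V) (hU' : ∀ x ∈ V, U.symm x ∈ V)
    {x y u v : E} {α β γ δ : ℂ} (hα : α ≠ 0) (hx : U x = α • u + β • v)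
    (hy : U y = γ • u + δ • v) (hxV : x ∈ V) (hvV : v ∈ V) : u ∈ V ∧ y ∈ V := by
  have hu : u ∈ V := by
    have h : α • u ∈ V := by
      rw [eq_sub_of_add_eq hx.symm]
      exact V.sub_mem (hU x hxV) (V.smul_mem _ hvV)
    exact (V.smul_mem_iff hα).mp h
  refine ⟨hu, ?_⟩
  have h : U y ∈ V := hy ▸ V.add_mem (V.smul_mem _ hu) (V.smul_mem _ hvV)
  simpa using hU' _ h

/-- A closed subspace of `ℓ²(ℤ × ℤ/2Mℤ)` containing the canonical basis is everything. -/
lemma eq_top_of_basis_mem {M : ℕ} {V : Submodule ℂ (Hcyl M)} (hV : IsClosed (V : Set (Hcyl M)))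
    (he : ∀ μ, e M μ ∈ V) : V = ⊤ := by
  refine V.eq_top_iff'.mpr fun f => ?_
  refine hV.mem_of_tendsto (lp.hasSum_single ENNReal.ofNat_ne_top f)
    (Filter.Eventually.of_forall fun s => V.sum_mem fun μ _ => ?_)
  have h : lp.single 2 μ (f μ) = f μ • e M μ := by
    rw [e, ← lp.single_smul, smul_eq_mul, mul_one]
  exact h ▸ V.smul_mem _ (he μ)

/-- Case distinction on the parity of a representative of a residue class. -/
lemma ZMod.forall_of_even_odd {n : ℕ} {P : ZMod n → Prop}
    (heven : ∀ k : ℤ, P ((2 * k : ℤ) : ZMod n)) (hodd : ∀ k : ℤ, P ((2 * k + 1 : ℤ) : ZMod n))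
    (κ : ZMod n) : P κ := by
  obtain ⟨m, rfl⟩ := ZMod.intCast_surjective κ
  obtain ⟨k, rfl | rfl⟩ := Int.even_or_odd' m
  exacts [heven k, hodd k]

/-- Assume `rt ≠ 0` (here `r, t ∈ (0,1)`, `r² + t² = 1`) and `M ≥ 1`.  Let
`U` be the Chalker–Coddington unitary on the cylinder `ℓ²(ℤ × ℤ/2Mℤ)`, with phase
configuration given by triples `pe j κ` (at the even node in column `2j`, row `κ = 2k`) and
`po j κ` (at the odd node in column `2j+1`, row `κ = 2k+1`), all of unit modulus; its columns
are listed in hypotheses `hU1`–`hU4`, all second indices being taken mod `2M`.  Then the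
vectors `e_{(0,κ)}`, `κ ∈ ℤ/2Mℤ`, span a cyclic subspace for `U`: the smallest closed subspace
containing them and invariant under both `U` and `U⁻¹` is the whole space. -/
theorem stmt_19 (M : ℕ) (hM : 1 ≤ M) (r t : ℝ) (hr : r ∈ Set.Ioo (0 : ℝ) 1)
    (ht : t ∈ Set.Ioo (0 : ℝ) 1) (hrt : r ^ 2 + t ^ 2 = 1)
    (pe po : ℤ → ZMod (2 * M) → ℂ × ℂ × ℂ)
    (hpe : ∀ j κ, ‖(pe j κ).1‖ = 1 ∧ ‖(pe j κ).2.1‖ = 1 ∧ ‖(pe j κ).2.2‖ = 1)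
    (hpo : ∀ j κ, ‖(po j κ).1‖ = 1 ∧ ‖(po j κ).2.1‖ = 1 ∧ ‖(po j κ).2.2‖ = 1)
    (U : Hcyl M ≃ₗᵢ[ℂ] Hcyl M)
    (hU1 : ∀ (j k : ℤ), U (e M (2 * j, ((2 * k : ℤ) : ZMod (2 * M)))) =
      S00 r t (pe j ((2 * k : ℤ) : ZMod (2 * M))) •
          e M (2 * j + 1, ((2 * k : ℤ) : ZMod (2 * M)))
        + S10 r t (pe j ((2 * k : ℤ) : ZMod (2 * M))) •
          e M (2 * j, ((2 * k + 1 : ℤ) : ZMod (2 * M))))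
    (hU2 : ∀ (j k : ℤ), U (e M (2 * j + 1, ((2 * k + 1 : ℤ) : ZMod (2 * M)))) =
      S01 r t (pe j ((2 * k : ℤ) : ZMod (2 * M))) •
          e M (2 * j + 1, ((2 * k : ℤ) : ZMod (2 * M)))
        + S11 r t (pe j ((2 * k : ℤ) : ZMod (2 * M))) •
          e M (2 * j, ((2 * k + 1 : ℤ) : ZMod (2 * M))))
    (hU3 : ∀ (j k : ℤ), U (e M (2 * j + 2, ((2 * k + 1 : ℤ) : ZMod (2 * M)))) =
      S00 r t (po j ((2 * k + 1 : ℤ) : ZMod (2 * M))) •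
          e M (2 * j + 2, ((2 * k + 2 : ℤ) : ZMod (2 * M)))
        + S10 r t (po j ((2 * k + 1 : ℤ) : ZMod (2 * M))) •
          e M (2 * j + 1, ((2 * k + 1 : ℤ) : ZMod (2 * M))))
    (hU4 : ∀ (j k : ℤ), U (e M (2 * j + 1, ((2 * k + 2 : ℤ) : ZMod (2 * M)))) =
      S01 r t (po j ((2 * k + 1 : ℤ) : ZMod (2 * M))) •
          e M (2 * j + 2, ((2 * k + 2 : ℤ) : ZMod (2 * M)))
        + S11 r t (po j ((2 * k + 1 : ℤ) : ZMod (2 * M))) •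
          e M (2 * j + 1, ((2 * k + 1 : ℤ) : ZMod (2 * M)))) :
    ∀ V : Submodule ℂ (Hcyl M), IsClosed (V : Set (Hcyl M)) →
      (∀ κ : ZMod (2 * M), e M (0, κ) ∈ V) →
      (∀ x ∈ V, U x ∈ V) → (∀ x ∈ V, U.symm x ∈ V) →
      V = ⊤ := by
  intro V hV h0 hU hU'
  have hpe' j κ := scattering_entries_ne_zero hr.1.ne' ht.1.ne' (hpe j κ)
  have hpo' j κ := scattering_entries_ne_zero hr.1.ne' ht.1.ne' (hpo j κ)
  have two_mul_pred (k : ℤ) : 2 * (k - 1) + 2 = 2 * k := by ring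
  have even_right (j : ℤ) (h : ∀ κ, e M (2 * j, κ) ∈ V) : ∀ κ, e M (2 * j + 1, κ) ∈ V := by
    have node (k : ℤ) := Submodule.mem_of_scattering hU hU' (hpe' j _).1 (hU1 j k) (hU2 j k)
      (h _) (h _)
    exact ZMod.forall_of_even_odd (fun k => (node k).1) fun k => (node k).2
  have odd_right (j : ℤ) (h : ∀ κ, e M (2 * j + 1, κ) ∈ V) : ∀ κ, e M (2 * j + 2, κ) ∈ V := by
    have node (k : ℤ) := Submodule.mem_of_scattering hU hU' (hpo' j _).2.1 (hU4 j k) (hU3 j k)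
      (h _) (h _)
    exact ZMod.forall_of_even_odd (fun k => two_mul_pred k ▸ (node (k - 1)).1)
      fun k => (node k).2
  have even_left (j : ℤ) (h : ∀ κ, e M (2 * j + 1, κ) ∈ V) : ∀ κ, e M (2 * j, κ) ∈ V := by
    have node (k : ℤ) := Submodule.mem_of_scattering hU hU' (hpe' j _).2.2.2
      ((hU2 j k).trans (add_comm _ _)) ((hU1 j k).trans (add_comm _ _)) (h _) (h _)
    exact ZMod.forall_of_even_odd (fun k => (node k).2) fun k => (node k).1
  have odd_left (j : ℤ) (h : ∀ κ, e M (2 * j + 2, κ) ∈ V) : ∀ κ, e M (2 * j + 1, κ) ∈ V := by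
    have node (k : ℤ) := Submodule.mem_of_scattering hU hU' (hpo' j _).2.2.1
      ((hU3 j k).trans (add_comm _ _)) ((hU4 j k).trans (add_comm _ _)) (h _) (h _)
    exact ZMod.forall_of_even_odd (fun k => two_mul_pred k ▸ (node (k - 1)).2)
      fun k => (node k).1
  have even_columns (j : ℤ) : ∀ κ, e M (2 * j, κ) ∈ V := by
    induction j with
    | zero => simpa using h0
    | succ i ih => simpa [mul_add] using odd_right _ (even_right _ ih)
    | pred i ih =>
      refine even_left _ (odd_left _ ?_)
      rwa [two_mul_pred]
  refine eq_top_of_basis_mem hV fun ⟨m, κ⟩ => ?_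
  obtain ⟨j, rfl | rfl⟩ := Int.even_or_odd' m
  exacts [even_columns j κ, even_right j (even_columns j) κ]
end
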